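/- arXiv:2106.12953 — 4 statements merged into one kernel-verified Lean document; each statement's English description precedes it below -/
import Mathlib

section
/- Let n be an odd positive integer and let ζ ∈ ℂ be a primitive n-th root of unity. Then ( ∏_{k=1}^{(n-1)/2} (1 - ζ^{2k-1}) )^2 = (-1)^{(n-1)/2} · ζ^{((n-1)/2)^2} · n. -/
theorem Finset.prod_range_two_mul_eq_mul {M : Type*} [CommMonoid M] (f : ℕ → M) (m : ℕ) :
    ∏ k ∈ Finset.range (2 * m), f k =
      (∏ k ∈ Finset.range m, f (2 * k)) * ∏ k ∈ Finset.range m, f (2 * k + 1) := by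
  induction m with
  | zero => simp
  | succ m ih =>
    rw [show 2 * (m + 1) = 2 * m + 1 + 1 by ring, Finset.prod_range_succ, Finset.prod_range_succ,
      ih, Finset.prod_range_succ, Finset.prod_range_succ, mul_assoc, mul_mul_mul_comm]

theorem prod_range_pow_two_mul_add_one {M : Type*} [CommMonoid M] (x : M) (m : ℕ) :
    ∏ k ∈ Finset.range m, x ^ (2 * k + 1) = x ^ m ^ 2 := by
  induction m with
  | zero => simp
  | succ m ih => rw [Finset.prod_range_succ, ih, ← pow_add]; congr 1; ring

theorem prod_one_sub_odd_pow_eq_mul_prod_one_sub_even_pow {R : Type*} [CommRing R] {x : R} {m : ℕ}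
    (hx : x ^ (2 * m + 1) = 1) :
    ∏ k ∈ Finset.range m, (1 - x ^ (2 * k + 1)) =
      (-1) ^ m * x ^ m ^ 2 * ∏ k ∈ Finset.range m, (1 - x ^ (2 * k + 2)) := by
  have h : ∀ k ∈ Finset.range m, 1 - x ^ (2 * k + 1) =
      -1 * x ^ (2 * k + 1) * (1 - x ^ (2 * (m - 1 - k) + 2)) := by
    intro k hk
    have hk := Finset.mem_range.mp hk
    have h1 : x ^ (2 * k + 1) * x ^ (2 * (m - 1 - k) + 2) = 1 := by
      rw [← pow_add, ← hx]
      congr 1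
      omega
    linear_combination -h1
  rw [Finset.prod_congr rfl h, Finset.prod_mul_distrib, Finset.prod_mul_distrib,
    prod_range_pow_two_mul_add_one, Finset.prod_const, Finset.card_range,
    Finset.prod_range_reflect (fun k => 1 - x ^ (2 * k + 2))]

theorem sq_prod_one_sub_odd_powers
    (n : ℕ) (hn : 0 < n) (hodd : Odd n) (ζ : ℂ) (hζ : IsPrimitiveRoot ζ n) :
    (∏ k ∈ Finset.Icc 1 ((n - 1) / 2), (1 - ζ ^ (2 * k - 1))) ^ 2 =
      (-1) ^ ((n - 1) / 2) * ζ ^ (((n - 1) / 2) ^ 2) * (n : ℂ) := by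
  obtain ⟨m, rfl⟩ := hodd
  have hm : (2 * m + 1 - 1) / 2 = m := by omega
  have hP : ∏ k ∈ Finset.Icc 1 m, (1 - ζ ^ (2 * k - 1)) =
      ∏ k ∈ Finset.range m, (1 - ζ ^ (2 * k + 1)) := by
    rw [← Finset.Ico_add_one_right_eq_Icc, Finset.prod_Ico_eq_prod_range, Nat.add_sub_cancel]
    refine Finset.prod_congr rfl fun k _ => ?_
    rw [show 2 * (1 + k) - 1 = 2 * k + 1 by omega]
  have hfull := hζ.prod_one_sub_pow_eq_order
  rw [Finset.prod_range_two_mul_eq_mul] at hfull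
  have hPE := prod_one_sub_odd_pow_eq_mul_prod_one_sub_even_pow hζ.pow_eq_one
  rw [hm, hP, sq]
  nth_rewrite 2 [hPE]
  push_cast at hfull ⊢
  linear_combination (-1) ^ m * ζ ^ m ^ 2 * hfull
end

section
/- Let n be an odd positive integer and let ζ ∈ ℂ be a primitive n-th root of unity. Then ( ∏_{k=1}^{(n-1)/2} (1 + ζ^{2k}) )^2 = ζ^{(n²-1)/4}. -/
/-- The factors `1 + μ ^ k`, over all nonzero exponents modulo an odd order, multiply to one. -/
lemma IsPrimitiveRoot.prod_range_one_add_pow {R : Type*} [CommRing R] [IsDomain R] [CharZero R]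
    {m : ℕ} {μ : R} (hμ : IsPrimitiveRoot μ (2 * m + 1)) :
    ∏ k ∈ Finset.range (2 * m), (1 + μ ^ (k + 1)) = 1 := by
  have hsq : IsPrimitiveRoot (μ ^ 2) (2 * m + 1) := hμ.pow_of_coprime 2 (by simp)
  have h₁ := hμ.prod_one_sub_pow_eq_order
  have h₂ := hsq.prod_one_sub_pow_eq_order
  have hfactor : ∀ k, 1 - (μ ^ 2) ^ (k + 1) = (1 - μ ^ (k + 1)) * (1 + μ ^ (k + 1)) := by
    intro k
    ring
  simp only [hfactor, Finset.prod_mul_distrib, h₁] at h₂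
  exact mul_left_cancel₀ (Nat.cast_add_one_ne_zero (2 * m)) (by simpa using h₂)

lemma prod_range_pow_two_mul_succ {M : Type*} [CommMonoid M] (x : M) (m : ℕ) :
    ∏ k ∈ Finset.range m, x ^ (2 * (k + 1)) = x ^ (m * (m + 1)) := by
  induction m with
  | zero => simp
  | succ m ih =>
    rw [Finset.prod_range_succ, ih, ← pow_add]
    congr 1
    ring

theorem sq_prod_one_add_even_powers
    (n : ℕ) (hn : 0 < n) (hodd : Odd n) (ζ : ℂ) (hζ : IsPrimitiveRoot ζ n) :
    (∏ k ∈ Finset.Icc 1 ((n - 1) / 2), (1 + ζ ^ (2 * k))) ^ 2 =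
      ζ ^ ((n ^ 2 - 1) / 4) := by
  obtain ⟨m, rfl⟩ := hodd
  have hm : (2 * m + 1 - 1) / 2 = m := by omega
  have he : ((2 * m + 1) ^ 2 - 1) / 4 = m * (m + 1) := by
    have : (2 * m + 1) ^ 2 = 4 * (m * (m + 1)) + 1 := by ring
    omega
  have hsq : IsPrimitiveRoot (ζ ^ 2) (2 * m + 1) := hζ.pow_of_coprime 2 (by simp)
  have hprod := hsq.prod_range_one_add_pow
  rw [two_mul m, Finset.prod_range_add,
    ← Finset.prod_range_reflect (fun k ↦ 1 + (ζ ^ 2) ^ (m + k + 1))] at hprod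
  have hreflect : (∏ k ∈ Finset.range m, (1 + (ζ ^ 2) ^ (m + (m - 1 - k) + 1))) *
      ζ ^ (m * (m + 1)) = ∏ k ∈ Finset.range m, (1 + (ζ ^ 2) ^ (k + 1)) := by
    rw [← prod_range_pow_two_mul_succ, ← Finset.prod_mul_distrib]
    refine Finset.prod_congr rfl fun k hk ↦ ?_
    have hk := Finset.mem_range.mp hk
    rw [pow_mul, add_mul, ← pow_add,
      show m + (m - 1 - k) + 1 + (k + 1) = 2 * m + 1 by omega, hsq.pow_eq_one]
    ring
  rw [hm, he, ← Finset.Ico_add_one_right_eq_Icc, Finset.prod_Ico_eq_prod_range]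
  simp only [add_tsub_cancel_right, pow_mul, add_comm 1 (_ : ℕ)]
  rw [← pow_mul]
  linear_combination (ζ ^ (m * (m + 1))) * hprod -
    (∏ k ∈ Finset.range m, (1 + (ζ ^ 2) ^ (k + 1))) * hreflect
end

section
/- Let n be an odd positive integer and let ζ ∈ ℂ be a primitive n-th root of unity. Then Σ_{k=0}^{(n-1)/2} (-1)^k (ζ;ζ²)_k / (-ζ;ζ)_k = Σ_{k=0}^{(n-1)/2} (-1)^k ζ^{2k²} (ζ²;ζ⁴)_k / (-ζ²;ζ²)_{2k}. That is, the sixth order mock theta functions μ and φ satisfy μ(ζ) = φ(ζ²). -/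
/-- The q-Pochhammer symbol `(a;q)_k = ∏_{j=0}^{k-1} (1 - a q^j)`. -/
noncomputable def qPoch (a q : ℂ) (k : ℕ) : ℂ :=
  ∏ j ∈ Finset.range k, (1 - a * q ^ j)

open Finset Filter Topology

section QPochhammer

variable {a q : ℂ} {n : ℕ}

lemma qPoch_zero (a q : ℂ) : qPoch a q 0 = 1 := by simp [qPoch]

lemma qPoch_succ (a q : ℂ) (k : ℕ) : qPoch a q (k + 1) = qPoch a q k * (1 - a * q ^ k) :=
  prod_range_succ _ _

lemma qPoch_add (a q : ℂ) (m k : ℕ) :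
    qPoch a q (m + k) = qPoch a q m * qPoch (a * q ^ m) q k := by
  simp only [qPoch, prod_range_add, pow_add, mul_assoc]

lemma qPoch_eq_zero {k m : ℕ} (h : a * q ^ m = 1) (hmk : m < k) : qPoch a q k = 0 :=
  prod_eq_zero (mem_range.2 hmk) (by rw [h, sub_self])

lemma qPoch_ne_zero_of_forall {k : ℕ} (h : ∀ j < k, a * q ^ j ≠ 1) : qPoch a q k ≠ 0 :=
  prod_ne_zero_iff.2 fun j hj => sub_ne_zero.2 (h j (mem_range.1 hj)).symm

lemma qPoch_ne_zero (hq : q ^ n = 1) (ha : a ^ n ≠ 1) (k : ℕ) : qPoch a q k ≠ 0 := by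
  refine qPoch_ne_zero_of_forall fun j _ h => ha ?_
  have := congrArg (· ^ n) h
  simpa [mul_pow, ← pow_mul, mul_comm j n, pow_mul q n, hq] using this

lemma qPoch_two_mul (a q : ℂ) (k : ℕ) :
    qPoch a q (2 * k) = qPoch a (q ^ 2) k * qPoch (a * q) (q ^ 2) k := by
  induction k with
  | zero => simp [qPoch_zero]
  | succ k ih =>
    rw [show 2 * (k + 1) = 2 * k + 1 + 1 by ring, qPoch_succ, qPoch_succ, ih, qPoch_succ, qPoch_succ]
    ring

lemma qPoch_mul_neg (a q : ℂ) (k : ℕ) :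
    qPoch a q k * qPoch (-a) q k = qPoch (a ^ 2) (q ^ 2) k := by
  simp only [qPoch, ← prod_mul_distrib]
  exact prod_congr rfl fun j _ => by ring

lemma IsPrimitiveRoot.qPoch_eq (hq : IsPrimitiveRoot q n) (hn : 0 < n) (a : ℂ) :
    qPoch a q n = 1 - a ^ n := by
  have h := hq.pow_sub_pow_eq_prod_sub_mul 1 a hn
  rw [one_pow] at h
  have hmap : Set.MapsTo (q ^ ·) (range n : Set ℕ) (Polynomial.nthRootsFinset n (1 : ℂ)) :=
    fun j _ => by
      simp [Polynomial.mem_nthRootsFinset hn, ← pow_mul, mul_comm j n, pow_mul q n, hq.pow_eq_one]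
  have hinj : Set.InjOn (q ^ ·) (range n : Set ℕ) := fun i hi j hj hij =>
    hq.pow_inj (mem_range.1 hi) (mem_range.1 hj) hij
  rw [h, qPoch]
  exact prod_nbij (q ^ ·) hmap hinj
    (surjOn_of_injOn_of_card_le _ hmap hinj (by simp [hq.card_nthRootsFinset]))
    fun j _ => by rw [mul_comm]

lemma IsPrimitiveRoot.qPoch_pred (hq : IsPrimitiveRoot q n) (hn : 0 < n) :
    qPoch q q (n - 1) = n := by
  obtain ⟨m, rfl⟩ : ∃ m, n = m + 1 := ⟨n - 1, by omega⟩
  simpa [qPoch, pow_succ'] using hq.prod_one_sub_pow_eq_order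

lemma IsPrimitiveRoot.qPoch_neg_pred (hq : IsPrimitiveRoot q n) (hn : Odd n) :
    qPoch (-q) q (n - 1) = 1 := by
  have h := hq.qPoch_eq hn.pos (-1)
  obtain ⟨m, rfl⟩ : ∃ m, n = m + 1 := ⟨n - 1, by have := hn.pos; omega⟩
  rw [add_comm m 1, qPoch_add, qPoch_succ, qPoch_zero, add_comm 1 m, hn.neg_one_pow] at h
  rw [Nat.add_sub_cancel]
  have : (2 : ℂ) * qPoch (-q) q m = 2 * 1 := by
    convert h using 1 <;> norm_num
  exact mul_left_cancel₀ two_ne_zero this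

end QPochhammer

section CyclicSums

variable {n : ℕ} {F : ℕ → ℂ}

lemma sum_range_shift (h : F n = F 0) : ∑ j ∈ range n, F (j + 1) = ∑ j ∈ range n, F j := by
  have h₁ := sum_range_succ F n
  rw [sum_range_succ', h] at h₁
  exact add_right_cancel h₁

lemma sum_range_double (hn : Odd n) (h : ∀ j, F (j + n) = F j) :
    ∑ j ∈ range n, F (2 * j) = ∑ j ∈ range n, F j := by
  have hp : Function.Periodic F n := h
  have hmap : Set.MapsTo (fun j => 2 * j % n) (range n : Set ℕ) (range n) :=
    fun j _ => by simpa using Nat.mod_lt _ hn.pos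
  have hinj : Set.InjOn (fun j => 2 * j % n) (range n : Set ℕ) := fun i hi j hj hij =>
    (Nat.ModEq.cancel_left_of_coprime (Nat.coprime_two_right.2 hn) hij).eq_of_lt_of_lt
      (by simpa using hi) (by simpa using hj)
  exact sum_nbij _ hmap hinj (surjOn_of_injOn_of_card_le _ hmap hinj le_rfl)
    fun j _ => (hp.map_mod_nat _).symm

lemma sum_moment {q t r : ℂ} {c : ℕ → ℂ} (hq : q ^ n = 1) (hper : c n = c 0)
    (hc : ∀ m, c (m + 1) * (1 - r * q ^ (m + 1)) = t * q * c m) (k : ℕ) :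
    ∑ m ∈ range n, c m * (r * q ^ m) ^ k = qPoch (t * q) q k * ∑ m ∈ range n, c m := by
  induction k with
  | zero => simp [qPoch_zero]
  | succ k ih =>
    have h₁ := sum_range_shift (n := n) (F := fun m => c m * (1 - r * q ^ m) * (r * q ^ m) ^ k)
      (by simp [hper, hq])
    have h₂ : ∑ m ∈ range n, c (m + 1) * (1 - r * q ^ (m + 1)) * (r * q ^ (m + 1)) ^ k =
        t * q * q ^ k * ∑ m ∈ range n, c m * (r * q ^ m) ^ k := by
      rw [mul_sum]
      refine sum_congr rfl fun m _ => ?_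
      rw [hc]; ring
    have h₃ : ∑ m ∈ range n, c m * (1 - r * q ^ m) * (r * q ^ m) ^ k =
        ∑ m ∈ range n, c m * (r * q ^ m) ^ k - ∑ m ∈ range n, c m * (r * q ^ m) ^ (k + 1) := by
      rw [← sum_sub_distrib]
      exact sum_congr rfl fun m _ => by ring
    rw [qPoch_succ]
    linear_combination (1 - t * q * q ^ k) * ih + h₁ + h₃ - h₂

lemma sum_inverse_moment {Q r v : ℂ} {d : ℕ → ℂ} (hQ : Q ^ n = 1) (hv : v ≠ 0)
    (hper : d n = d 0)
    (hd : ∀ k, d (k + 1) * (Q ^ (2 * k + 2) - v) = r ^ 2 * Q ^ (2 * k + 1) * d k) (j : ℕ) :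
    (∑ k ∈ range n, d k * (Q ^ (2 * k) / v) ^ j) * qPoch (r ^ 2 * Q) (Q ^ 2) j =
      ∑ k ∈ range n, d k := by
  induction j with
  | zero => simp [qPoch_zero]
  | succ j ih =>
    have h₁ := sum_range_shift (n := n)
      (F := fun k => d k * (1 - Q ^ (2 * k) / v) * (Q ^ (2 * k) / v) ^ j)
      (by simp [hper, mul_comm 2 n, pow_mul, hQ])
    have h₂ : ∑ k ∈ range n, d (k + 1) * (1 - Q ^ (2 * (k + 1)) / v) *
          (Q ^ (2 * (k + 1)) / v) ^ j =
        -(r ^ 2 * Q * (Q ^ 2) ^ j) * ∑ k ∈ range n, d k * (Q ^ (2 * k) / v) ^ (j + 1) := by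
      rw [mul_sum]
      refine sum_congr rfl fun k _ => ?_
      have : d (k + 1) * (1 - Q ^ (2 * (k + 1)) / v) = -(r ^ 2 * Q ^ (2 * k + 1) * d k) / v := by
        rw [← hd]; field_simp; ring
      rw [this]; ring
    have h₃ : ∑ k ∈ range n, d k * (1 - Q ^ (2 * k) / v) * (Q ^ (2 * k) / v) ^ j =
        ∑ k ∈ range n, d k * (Q ^ (2 * k) / v) ^ j -
          ∑ k ∈ range n, d k * (Q ^ (2 * k) / v) ^ (j + 1) := by
      rw [← sum_sub_distrib]
      exact sum_congr rfl fun k _ => by ring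
    rw [qPoch_succ, ← ih]
    linear_combination qPoch (r ^ 2 * Q) (Q ^ 2) j * (h₁ + h₃ - h₂)

lemma sum_mul_qPoch {Q r : ℂ} {w : ℕ → ℂ} (hQ : Q ^ n = 1)
    (hw : ∀ j, w (j + 1) * (1 - r * Q ^ (j + 1)) = (1 + r * Q ^ j) * w j) (x : ℂ)
    (hper : x ^ n * w n = w 0) (m : ℕ) :
    (∑ j ∈ range n, x ^ j * w j) * qPoch x Q m =
      r ^ m * qPoch (-x) Q m * ∑ j ∈ range n, (x * Q ^ m) ^ j * w j := by
  induction m with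
  | zero => simp [qPoch_zero]
  | succ m ih =>
    have h₁ := sum_range_shift (n := n)
      (F := fun j => (x * Q ^ m) ^ j * (w j * (1 - r * Q ^ j)))
      (by simp [mul_pow, ← pow_mul, mul_comm m n, pow_mul Q n, hQ, ← mul_assoc, hper])
    have h₂ : ∑ j ∈ range n, (x * Q ^ m) ^ (j + 1) * (w (j + 1) * (1 - r * Q ^ (j + 1))) =
        x * Q ^ m * (∑ j ∈ range n, (x * Q ^ m) ^ j * w j +
          r * ∑ j ∈ range n, (x * Q ^ (m + 1)) ^ j * w j) := by
      rw [mul_sum, ← sum_add_distrib, mul_sum]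
      refine sum_congr rfl fun j _ => ?_
      rw [hw]; ring
    have h₃ : ∑ j ∈ range n, (x * Q ^ m) ^ j * (w j * (1 - r * Q ^ j)) =
        ∑ j ∈ range n, (x * Q ^ m) ^ j * w j -
          r * ∑ j ∈ range n, (x * Q ^ (m + 1)) ^ j * w j := by
      rw [mul_sum, ← sum_sub_distrib]
      refine sum_congr rfl fun j _ => ?_
      ring
    rw [qPoch_succ, qPoch_succ, ← mul_assoc, ih]
    linear_combination r ^ m * qPoch (-x) Q m * (h₂ - h₁ - h₃)

end CyclicSums

section FiniteTransform

variable {q Q t r v z : ℂ} {n N : ℕ} {a : ℕ → ℂ}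

lemma one_add_mul_sum_eq (hN : q * Q ^ N = 1)
    (ha : ∀ k < N, a (k + 1) * (1 - Q ^ (k + 1)) = -(1 - q * Q ^ k) * a k) (x : ℂ) :
    (1 + x) * ∑ k ∈ range (N + 1), a k * x ^ k =
      (1 + q * x) * ∑ k ∈ range (N + 1), a k * (Q * x) ^ k := by
  have h₁ : ∑ k ∈ range (N + 1), a k * (1 - Q ^ k) * x ^ k =
      -x * ∑ k ∈ range (N + 1), a k * (1 - q * Q ^ k) * x ^ k := by
    rw [sum_range_succ', sum_range_succ, hN, pow_zero, sub_self, mul_zero, zero_mul,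
      mul_zero, zero_mul, add_zero, add_zero, mul_sum]
    refine sum_congr rfl fun k hk => ?_
    rw [ha k (mem_range.1 hk)]; ring
  have h₂ : ∑ k ∈ range (N + 1), a k * (1 - Q ^ k) * x ^ k =
      ∑ k ∈ range (N + 1), a k * x ^ k - ∑ k ∈ range (N + 1), a k * (Q * x) ^ k := by
    rw [← sum_sub_distrib]
    exact sum_congr rfl fun k _ => by ring
  have h₃ : ∑ k ∈ range (N + 1), a k * (1 - q * Q ^ k) * x ^ k =
      ∑ k ∈ range (N + 1), a k * x ^ k - q * ∑ k ∈ range (N + 1), a k * (Q * x) ^ k := by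
    rw [mul_sum, ← sum_sub_distrib]
    exact sum_congr rfl fun k _ => by ring
  linear_combination h₁ - h₂ - x * h₃

lemma sum_mul_qPoch_neg (hN : q * Q ^ N = 1)
    (ha : ∀ k < N, a (k + 1) * (1 - Q ^ (k + 1)) = -(1 - q * Q ^ k) * a k) (r : ℂ) (j : ℕ) :
    (∑ k ∈ range (N + 1), a k * (r * Q ^ j) ^ k) * qPoch (-(r * q)) Q j =
      qPoch (-r) Q j * ∑ k ∈ range (N + 1), a k * r ^ k := by
  induction j with
  | zero => simp [qPoch_zero]
  | succ j ih =>
    have h := one_add_mul_sum_eq hN ha (r * Q ^ j)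
    rw [mul_left_comm Q r, ← pow_succ'] at h
    rw [qPoch_succ, qPoch_succ]
    linear_combination (1 + r * Q ^ j) * ih - qPoch (-(r * q)) Q j * h

lemma qPoch_two_mul_mul_neg (q r : ℂ) (j : ℕ) :
    qPoch (r * q) q (2 * j) * qPoch (-(r * q)) (q ^ 2) j =
      qPoch (r * q ^ 2) (q ^ 2) j * qPoch (r ^ 2 * q ^ 2) ((q ^ 2) ^ 2) j := by
  have h := qPoch_mul_neg (r * q) (q ^ 2) j
  rw [mul_pow] at h
  rw [← h, qPoch_two_mul, mul_assoc r q q, ← sq]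
  ring

lemma pow_div_qPoch_add (hq : IsPrimitiveRoot q n) (hn : 0 < n) (hr : r ^ n ≠ 1)
    (ht : t ^ n = 1 - r ^ n) (m : ℕ) :
    (t * q) ^ (m + n) / qPoch (r * q) q (m + n) = (t * q) ^ m / qPoch (r * q) q m := by
  have hqn := hq.pow_eq_one
  have h : qPoch (r * q) q n = t ^ n := by rw [hq.qPoch_eq hn, mul_pow, hqn, mul_one, ht]
  have ht₀ : t ^ n ≠ 0 := by rwa [ht, sub_ne_zero, ne_comm]
  rw [add_comm m n, qPoch_add, h, hqn, mul_one, pow_add, mul_pow t q n, hqn, mul_one,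
    mul_div_mul_left _ _ ht₀]

lemma sum_pow_div_qPoch_mul_pow (hq : IsPrimitiveRoot q n) (hn : 0 < n) (hr : r ^ n ≠ 1)
    (ht : t ^ n = 1 - r ^ n) (k : ℕ) :
    ∑ m ∈ range n, (t * q) ^ m / qPoch (r * q) q m * (r * q ^ m) ^ k =
      qPoch (t * q) q k * ∑ m ∈ range n, (t * q) ^ m / qPoch (r * q) q m := by
  have hqn := hq.pow_eq_one
  have h : ∀ m, qPoch (r * q) q m ≠ 0 := qPoch_ne_zero hqn (by rwa [mul_pow, hqn, mul_one])
  refine sum_moment hqn (by simpa using pow_div_qPoch_add hq hn hr ht 0) (fun m => ?_) k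
  rw [div_mul_eq_mul_div, mul_div_assoc', div_eq_div_iff (h _) (h _), qPoch_succ]
  ring

lemma sum_pow_mul_div_mul_qPoch (hQ : IsPrimitiveRoot Q n) (hn : Odd n) (hr : r ^ n ≠ 1)
    (hz : z ^ n * (1 + r ^ n) = 1 - r ^ n) (m : ℕ) :
    (∑ j ∈ range n, z ^ j * (qPoch (-r) Q j / qPoch (r * Q) Q j)) * qPoch z Q m =
      r ^ m * qPoch (-z) Q m *
        ∑ j ∈ range n, (z * Q ^ m) ^ j * (qPoch (-r) Q j / qPoch (r * Q) Q j) := by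
  have hQn := hQ.pow_eq_one
  have h : ∀ j, qPoch (r * Q) Q j ≠ 0 := qPoch_ne_zero hQn (by rwa [mul_pow, hQn, mul_one])
  refine sum_mul_qPoch (w := fun j => qPoch (-r) Q j / qPoch (r * Q) Q j) hQn (fun j => ?_) z ?_ m
  · rw [div_mul_eq_mul_div, mul_div_assoc', div_eq_div_iff (h _) (h _), qPoch_succ, qPoch_succ]
    ring
  · simp only [qPoch_zero, hQ.qPoch_eq hn.pos, hn.neg_pow, mul_pow, hQn, mul_one,
      sub_neg_eq_add, div_one]
    rw [mul_div_assoc', hz, div_self (sub_ne_zero.2 hr.symm)]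

lemma sum_mul_sum_eq_sum (hq : IsPrimitiveRoot q n) (hn : Odd n) (hN : q * (q ^ 2) ^ N = 1)
    (ha : ∀ k < N, a (k + 1) * (1 - (q ^ 2) ^ (k + 1)) = -(1 - q * (q ^ 2) ^ k) * a k)
    (hr : r ^ n ≠ 1) (hr' : r ^ n ≠ -1) (ht : t ^ n = 1 - r ^ n) :
    (∑ k ∈ range (N + 1), a k * qPoch (t * q) q k) *
        ∑ m ∈ range n, (t * q) ^ m / qPoch (r * q) q m =
      (∑ k ∈ range (N + 1), a k * r ^ k) * ∑ j ∈ range n, (t ^ 2 * q ^ 2) ^ j *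
        (qPoch (-r) (q ^ 2) j / qPoch (r * q ^ 2) (q ^ 2) j) /
          qPoch (r ^ 2 * q ^ 2) ((q ^ 2) ^ 2) j := by
  have hqn := hq.pow_eq_one
  have hQn : (q ^ 2) ^ n = 1 := by rw [← pow_mul, mul_comm, pow_mul, hqn, one_pow]
  have hQn' : ((q ^ 2) ^ 2) ^ n = 1 := by rw [← pow_mul, mul_comm, pow_mul, hQn, one_pow]
  have hrq : (r * q) ^ n = r ^ n := by rw [mul_pow, hqn, mul_one]
  have h₁ : ∀ m, qPoch (r * q) q m ≠ 0 := qPoch_ne_zero hqn (by rwa [hrq])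
  have h₂ : ∀ j, qPoch (-(r * q)) (q ^ 2) j ≠ 0 := qPoch_ne_zero hQn (by
    rw [hn.neg_pow, hrq]; exact fun h => hr' (by rw [← h, neg_neg]))
  have h₃ : ∀ j, qPoch (r * q ^ 2) (q ^ 2) j ≠ 0 :=
    qPoch_ne_zero hQn (by rwa [mul_pow, hQn, mul_one])
  have h₄ : ∀ j, qPoch (r ^ 2 * q ^ 2) ((q ^ 2) ^ 2) j ≠ 0 := by
    refine qPoch_ne_zero hQn' ?_
    rw [mul_pow, hQn, mul_one, ← pow_mul, mul_comm 2 n, pow_mul]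
    exact fun h => (sq_eq_sq_iff_eq_or_eq_neg.1 (h.trans (one_pow 2).symm)).elim hr hr'
  have hmom := sum_pow_div_qPoch_mul_pow hq hn.pos hr ht
  have hcn := pow_div_qPoch_add hq hn.pos hr ht
  set c : ℕ → ℂ := fun m => (t * q) ^ m / qPoch (r * q) q m with hc
  have hper : ∀ m, c (m + n) * ∑ k ∈ range (N + 1), a k * (r * q ^ (m + n)) ^ k =
      c m * ∑ k ∈ range (N + 1), a k * (r * q ^ m) ^ k := fun m => by
    simp only [hc]
    rw [hcn, pow_add, hqn, mul_one]
  have hdouble := sum_range_double (F := fun m => c m * ∑ k ∈ range (N + 1), a k * (r * q ^ m) ^ k)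
    hn hper
  calc _ = ∑ m ∈ range n, c m * ∑ k ∈ range (N + 1), a k * (r * q ^ m) ^ k := by
        rw [sum_mul]
        simp_rw [mul_assoc, ← hmom, mul_sum]
        rw [sum_comm]
        exact sum_congr rfl fun m _ => sum_congr rfl fun k _ => by ring
    _ = _ := by
        rw [← hdouble, mul_sum]
        refine sum_congr rfl fun j _ => ?_
        have e₁ := sum_mul_qPoch_neg hN ha r j
        have e₂ := qPoch_two_mul_mul_neg q r j
        rw [← eq_div_iff (h₂ j)] at e₁
        have h5 := h₁ (2 * j)
        have h6 := h₂ j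
        have h7 := h₃ j
        have h8 := h₄ j
        simp only [hc]
        rw [pow_mul q 2 j, e₁, div_mul_div_comm, e₂, pow_mul (t * q) 2 j, mul_pow t q 2]
        field_simp

lemma prod_pow_sub_eq (hQ : IsPrimitiveRoot Q n) (hn : Odd n) (hv : v ≠ 0) :
    ∏ i ∈ range n, (Q ^ (2 * i + 2) - v) = 1 - v ^ n := by
  have hQ2 : IsPrimitiveRoot (Q ^ 2) n := hQ.pow_of_coprime 2 (Nat.coprime_two_left.2 hn)
  have h := hQ2.qPoch_eq hn.pos (Q ^ 2 / v)
  have : ∏ i ∈ range n, (Q ^ (2 * i + 2) - v) = (-v) ^ n * qPoch (Q ^ 2 / v) (Q ^ 2) n := by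
    nth_rewrite 2 [← card_range n]
    rw [qPoch, ← prod_const, ← prod_mul_distrib]
    refine prod_congr rfl fun i _ => ?_
    field_simp
    ring
  rw [this, h, div_pow, hQ2.pow_eq_one, hn.neg_pow]
  field_simp
  ring

lemma pow_mul_one_add_eq (hQ : Q ^ n = 1) (hr : r ^ n ≠ 1) (hv : v ^ n = 1 - r ^ (2 * n))
    (ht : t ^ n = 1 - r ^ n) (hz : z * v = t ^ 2 * Q) : z ^ n * (1 + r ^ n) = 1 - r ^ n := by
  have h := congrArg (· ^ n) hz
  simp only [mul_pow, hQ, hv, ← pow_mul, mul_one] at h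
  rw [mul_comm 2 n, pow_mul, pow_mul, ht] at h
  exact mul_right_cancel₀ (sub_ne_zero.2 hr.symm) (by linear_combination h)

lemma sum_mul_sum_eq_mul_sum (hQ : IsPrimitiveRoot Q n) (hn : Odd n) (hr₀ : r ≠ 0)
    (hr : r ^ n ≠ 1) (hr' : r ^ n ≠ -1) (hv₀ : v ≠ 0) (hv : v ^ n = 1 - r ^ (2 * n))
    (ht : t ^ n = 1 - r ^ n) (hz : z * v = t ^ 2 * Q) :
    (∑ j ∈ range n, (t ^ 2 * Q) ^ j * (qPoch (-r) Q j / qPoch (r * Q) Q j) /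
          qPoch (r ^ 2 * Q) (Q ^ 2) j) *
        ∑ k ∈ range n, r ^ (2 * k) * Q ^ (k ^ 2) / ∏ i ∈ range k, (Q ^ (2 * i + 2) - v) =
      (∑ j ∈ range n, z ^ j * (qPoch (-r) Q j / qPoch (r * Q) Q j)) *
        ∑ k ∈ range n, Q ^ (k ^ 2) / (∏ i ∈ range k, (Q ^ (2 * i + 2) - v)) *
          (qPoch z Q (2 * k) / qPoch (-z) Q (2 * k)) := by
  have hQn := hQ.pow_eq_one
  have hQn' : (Q ^ 2) ^ n = 1 := by rw [← pow_mul, mul_comm, pow_mul, hQn, one_pow]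
  have hr2 : r ^ (2 * n) ≠ 1 := by
    rw [mul_comm, pow_mul]
    exact fun h => (sq_eq_sq_iff_eq_or_eq_neg.1 (h.trans (one_pow 2).symm)).elim hr hr'
  have hv1 : v ^ n ≠ 1 := by
    rw [hv, Ne, sub_eq_self]
    exact pow_ne_zero _ hr₀
  have hzn := pow_mul_one_add_eq hQ.pow_eq_one hr hv ht hz
  have hQv : ∀ k, Q ^ (2 * k + 2) - v ≠ 0 := fun k h => hv1 (by
    rw [← sub_eq_zero.1 h, ← pow_mul, mul_comm, pow_mul, hQn, one_pow])
  have h₂ : ∀ j, qPoch (r ^ 2 * Q) (Q ^ 2) j ≠ 0 :=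
    qPoch_ne_zero hQn' (by rwa [mul_pow, hQn, mul_one, ← pow_mul])
  have h₃ : ∀ j, qPoch (-z) Q j ≠ 0 := by
    refine qPoch_ne_zero hQn fun h => ?_
    rw [hn.neg_pow, neg_eq_iff_eq_neg] at h
    rw [h] at hzn
    exact two_ne_zero (α := ℂ) (by linear_combination -hzn)
  have hg := sum_pow_mul_div_mul_qPoch hQ hn hr hzn
  set w : ℕ → ℂ := fun j => qPoch (-r) Q j / qPoch (r * Q) Q j with hw
  set d : ℕ → ℂ := fun k =>
    r ^ (2 * k) * Q ^ (k ^ 2) / ∏ i ∈ range k, (Q ^ (2 * i + 2) - v) with hd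
  have hdn : d n = d 0 := by
    have : r ^ (2 * n) ≠ 0 := pow_ne_zero _ hr₀
    simp only [hd, prod_pow_sub_eq hQ hn hv₀, hv, sq n, pow_mul Q n n, hQn]
    simp [this]
  have hds : ∀ k, d (k + 1) * (Q ^ (2 * k + 2) - v) = r ^ 2 * Q ^ (2 * k + 1) * d k := fun k => by
    have h5 := hQv k
    simp only [hd]
    rw [prod_range_succ, ← div_div, div_mul_cancel₀ _ h5, mul_div_assoc']
    ring
  have hmom := sum_inverse_moment hQn hv₀ hdn hds
  calc _ = ∑ j ∈ range n, ∑ k ∈ range n, d k * ((z * Q ^ (2 * k)) ^ j * w j) := by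
        rw [sum_mul]
        refine sum_congr rfl fun j _ => ?_
        have h5 := h₂ j
        rw [← hmom j, ← hz, div_mul_eq_mul_div, mul_comm (∑ k ∈ range n, _) (qPoch _ _ _),
          ← mul_assoc, mul_right_comm, mul_div_cancel_right₀ _ h5, mul_sum]
        refine sum_congr rfl fun k _ => ?_
        simp only [hw]
        rw [div_pow, mul_pow, mul_pow]
        field_simp
    _ = ∑ k ∈ range n, d k * ∑ j ∈ range n, (z * Q ^ (2 * k)) ^ j * w j := by
        rw [sum_comm]
        simp_rw [mul_sum]
    _ = _ := by
        rw [mul_sum]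
        refine sum_congr rfl fun k _ => ?_
        have h5 := h₃ (2 * k)
        have h6 := hg (2 * k)
        simp only [hd]
        rw [mul_div_assoc', mul_div_assoc', eq_div_iff h5]
        linear_combination (-(Q ^ (k ^ 2) / ∏ i ∈ range k, (Q ^ (2 * i + 2) - v))) * h6

lemma finite_transform (hq : IsPrimitiveRoot q n) (hn : Odd n) (hN : q * (q ^ 2) ^ N = 1)
    (ha : ∀ k < N, a (k + 1) * (1 - (q ^ 2) ^ (k + 1)) = -(1 - q * (q ^ 2) ^ k) * a k)
    (hQ : Q = q ^ 2) (hr₀ : r ≠ 0) (hr : r ^ n ≠ 1) (hr' : r ^ n ≠ -1) (hv₀ : v ≠ 0)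
    (hv : v ^ n = 1 - r ^ (2 * n)) (ht : t ^ n = 1 - r ^ n) (hz : z * v = t ^ 2 * Q) :
    (∑ k ∈ range (N + 1), a k * qPoch (t * q) q k) *
        (∑ k ∈ range n, r ^ (2 * k) * Q ^ (k ^ 2) / ∏ i ∈ range k, (Q ^ (2 * i + 2) - v)) *
        (∑ m ∈ range n, (t * q) ^ m / qPoch (r * q) q m * (q ^ m) ^ (n - 1)) *
        qPoch z Q (n - 1) =
      (∑ k ∈ range (N + 1), a k * r ^ k) * qPoch (t * q) q (n - 1) * qPoch (-z) Q (n - 1) *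
        (∑ j ∈ range n, (z * Q ^ (n - 1)) ^ j * (qPoch (-r) Q j / qPoch (r * Q) Q j)) *
        ∑ k ∈ range n, Q ^ (k ^ 2) / (∏ i ∈ range k, (Q ^ (2 * i + 2) - v)) *
          (qPoch z Q (2 * k) / qPoch (-z) Q (2 * k)) := by
  subst hQ
  have hQ : IsPrimitiveRoot (q ^ 2) n := hq.pow_of_coprime 2 (Nat.coprime_two_left.2 hn)
  have h₁ := sum_mul_sum_eq_sum hq hn hN ha hr hr' ht
  have h₂ := sum_mul_sum_eq_mul_sum hQ hn hr₀ hr hr' hv₀ hv ht hz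
  have h₃ := sum_pow_div_qPoch_mul_pow hq hn.pos hr ht (n - 1)
  have h₄ := sum_pow_mul_div_mul_qPoch hQ hn hr
    (pow_mul_one_add_eq hQ.pow_eq_one hr hv ht hz) (n - 1)
  simp_rw [mul_pow r, mul_left_comm _ (r ^ (n - 1)), ← mul_sum] at h₃
  set L := ∑ k ∈ range (N + 1), a k * qPoch (t * q) q k
  set p := ∑ k ∈ range (N + 1), a k * r ^ k
  set f := ∑ k ∈ range n,
    r ^ (2 * k) * (q ^ 2) ^ (k ^ 2) / ∏ i ∈ range k, ((q ^ 2) ^ (2 * i + 2) - v)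
  set e := ∑ m ∈ range n, (t * q) ^ m / qPoch (r * q) q m
  set R := ∑ k ∈ range n, (q ^ 2) ^ (k ^ 2) / (∏ i ∈ range k, ((q ^ 2) ^ (2 * i + 2) - v)) *
    (qPoch z (q ^ 2) (2 * k) / qPoch (-z) (q ^ 2) (2 * k))
  refine mul_left_cancel₀ (pow_ne_zero (n - 1) hr₀) ?_
  linear_combination L * f * qPoch z (q ^ 2) (n - 1) * h₃ +
    qPoch (t * q) q (n - 1) * f * qPoch z (q ^ 2) (n - 1) * h₁ +
    p * qPoch (t * q) q (n - 1) * qPoch z (q ^ 2) (n - 1) * h₂ +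
    p * qPoch (t * q) q (n - 1) * R * h₄

end FiniteTransform

section Limit

variable {q Q : ℂ} {n N : ℕ} {a : ℕ → ℂ}

lemma Filter.Tendsto.qPoch {α : Type*} {l : Filter α} {f : α → ℂ} {b : ℂ}
    (hf : Tendsto f l (𝓝 b)) (q : ℂ) (k : ℕ) :
    Tendsto (fun x => _root_.qPoch (f x) q k) l (𝓝 (_root_.qPoch b q k)) :=
  tendsto_finsetProd _ fun _ _ => (hf.mul_const _).const_sub 1

lemma qPoch_base_zero (q : ℂ) (k : ℕ) : qPoch 0 q k = 1 := by simp [qPoch]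

lemma exists_tendsto_parameters (hn : 0 < n) (Q : ℂ) : ∃ r t v z : ℝ → ℂ,
    Tendsto r (𝓝[>] 0) (𝓝 0) ∧ Tendsto t (𝓝[>] 0) (𝓝 1) ∧ Tendsto v (𝓝[>] 0) (𝓝 1) ∧
    Tendsto z (𝓝[>] 0) (𝓝 Q) ∧ ∀ᶠ x in 𝓝[>] 0, r x ≠ 0 ∧ r x ^ n ≠ 1 ∧ r x ^ n ≠ -1 ∧
      v x ≠ 0 ∧ v x ^ n = 1 - r x ^ (2 * n) ∧ t x ^ n = 1 - r x ^ n ∧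
      z x * v x = t x ^ 2 * Q := by
  have key : ∀ k : ℕ, 0 < k →
      Tendsto (fun x : ℝ => (((1 - x ^ k) ^ (1 / n : ℝ) : ℝ) : ℂ)) (𝓝[>] 0) (𝓝 1) := by
    intro k hk
    have h₁ : Tendsto (fun x : ℝ => 1 - x ^ k) (𝓝 0) (𝓝 1) := by
      have : Continuous fun x : ℝ => 1 - x ^ k := by fun_prop
      simpa [hk.ne'] using this.tendsto 0
    have h₂ := h₁.rpow_const (p := (1 / n : ℝ)) (Or.inl one_ne_zero)
    rw [Real.one_rpow] at h₂
    exact_mod_cast ((Complex.continuous_ofReal.tendsto 1).comp h₂).mono_left nhdsWithin_le_nhds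
  have hroot : ∀ y : ℝ, 0 < y → ((y ^ (1 / n : ℝ) : ℝ) : ℂ) ^ n = y := fun y hy => by
    rw [← Complex.ofReal_pow, one_div, Real.rpow_inv_natCast_pow hy.le hn.ne']
  have ht := key n hn
  have hv := key (2 * n) (by omega)
  refine ⟨(↑), fun x => (((1 - x ^ n) ^ (1 / n : ℝ) : ℝ) : ℂ),
    fun x => (((1 - x ^ (2 * n)) ^ (1 / n : ℝ) : ℝ) : ℂ),
    fun x => (((1 - x ^ n) ^ (1 / n : ℝ) : ℝ) : ℂ) ^ 2 * Q /
      (((1 - x ^ (2 * n)) ^ (1 / n : ℝ) : ℝ) : ℂ), ?_, ht, hv, ?_, ?_⟩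
  · exact_mod_cast (Complex.continuous_ofReal.tendsto 0).mono_left nhdsWithin_le_nhds
  · have h := ((ht.pow 2).mul_const Q).div hv one_ne_zero
    rwa [one_pow, one_mul, div_one] at h
  · filter_upwards [Ioo_mem_nhdsGT (zero_lt_one' ℝ)] with x hx
    have hx₁ : x ^ n < 1 := pow_lt_one₀ hx.1.le hx.2 hn.ne'
    have hx₂ : x ^ (2 * n) < 1 := pow_lt_one₀ hx.1.le hx.2 (by omega)
    have hv₀ : (((1 - x ^ (2 * n)) ^ (1 / n : ℝ) : ℝ) : ℂ) ≠ 0 := by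
      exact_mod_cast (Real.rpow_pos_of_pos (sub_pos.2 hx₂) _).ne'
    have hpos := pow_pos hx.1 n
    refine ⟨by exact_mod_cast hx.1.ne', by exact_mod_cast hx₁.ne, ?_, hv₀, ?_, ?_,
      div_mul_cancel₀ _ hv₀⟩
    · exact_mod_cast (show x ^ n ≠ -1 by linarith)
    · rw [hroot _ (sub_pos.2 hx₂)]; push_cast; rfl
    · rw [hroot _ (sub_pos.2 hx₁)]; push_cast; rfl

lemma qPoch_neg_self_ne_zero (hQ : Q ^ n = 1) (hn : Odd n) (k : ℕ) : qPoch (-Q) Q k ≠ 0 :=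
  qPoch_ne_zero hQ (by rw [hn.neg_pow, hQ]; norm_num) k

lemma sum_mul_qPoch_eq_sum (hq : IsPrimitiveRoot q n) (hn : Odd n) (hN : q * (q ^ 2) ^ N = 1)
    (ha : ∀ k < N, a (k + 1) * (1 - (q ^ 2) ^ (k + 1)) = -(1 - q * (q ^ 2) ^ k) * a k)
    (ha₀ : a 0 = 1) (hQ : Q = q ^ 2) :
    ∑ k ∈ range (N + 1), a k * qPoch q q k =
      ∑ k ∈ range n, Q ^ (k ^ 2) / (∏ i ∈ range k, (Q ^ (2 * i + 2) - 1)) *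
        (qPoch Q Q (2 * k) / qPoch (-Q) Q (2 * k)) := by
  have hQp : IsPrimitiveRoot Q n := hQ ▸ hq.pow_of_coprime 2 (Nat.coprime_two_left.2 hn)
  have hQp' : IsPrimitiveRoot (Q ^ 2) n := hQp.pow_of_coprime 2 (Nat.coprime_two_left.2 hn)
  obtain ⟨r, t, v, z, hr, ht, hv, hz, hev⟩ := exists_tendsto_parameters hn.pos Q
  have hprod : ∀ k ∈ range n, ∏ i ∈ range k, (Q ^ (2 * i + 2) - 1) ≠ 0 := fun k hk =>
    prod_ne_zero_iff.2 fun i hi => by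
      have := hQp'.pow_ne_one_of_pos_of_lt (l := i + 1) (by omega)
        (by have := mem_range.1 hk; have := mem_range.1 hi; omega)
      rwa [← pow_mul, ← sub_ne_zero] at this
  have hprod_lim : ∀ k, Tendsto (fun x => ∏ i ∈ range k, (Q ^ (2 * i + 2) - v x)) (𝓝[>] 0)
      (𝓝 (∏ i ∈ range k, (Q ^ (2 * i + 2) - 1))) := fun k =>
    tendsto_finsetProd _ fun i _ => hv.const_sub _
  have hL := tendsto_finsetSum (range (N + 1)) fun k _ =>
    ((ht.mul_const q).qPoch q k).const_mul (a k)
  have hf := tendsto_finsetSum (range n) fun k hk =>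
    ((hr.pow (2 * k)).mul_const (Q ^ (k ^ 2))).div (hprod_lim k) (hprod k hk)
  have hh := tendsto_finsetSum (range n) fun m _ =>
    (((ht.mul_const q).pow m).div ((hr.mul_const q).qPoch q m)
      (by rw [zero_mul, qPoch_base_zero]; exact one_ne_zero)).mul_const ((q ^ m) ^ (n - 1))
  have hp := tendsto_finsetSum (range (N + 1)) fun k _ => (hr.pow k).const_mul (a k)
  have hg := tendsto_finsetSum (range n) fun j _ =>
    ((hz.mul_const (Q ^ (n - 1))).pow j).mul ((hr.neg.qPoch Q j).div ((hr.mul_const Q).qPoch Q j)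
      (by rw [zero_mul, qPoch_base_zero]; exact one_ne_zero))
  have hR := tendsto_finsetSum (range n) fun k hk =>
    ((tendsto_const_nhds (x := Q ^ (k ^ 2))).div (hprod_lim k) (hprod k hk)).mul
      ((hz.qPoch Q (2 * k)).div (hz.neg.qPoch Q (2 * k))
        (qPoch_neg_self_ne_zero hQp.pow_eq_one hn _))
  have hleft := ((hL.mul hf).mul hh).mul (hz.qPoch Q (n - 1))
  have hright := (((hp.mul ((ht.mul_const q).qPoch q (n - 1))).mul
    (hz.neg.qPoch Q (n - 1))).mul hg).mul hR
  have heq := tendsto_nhds_unique_of_eventuallyEq hleft hright (by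
    filter_upwards [hev] with x ⟨h₁, h₂, h₃, h₄, h₅, h₆, h₇⟩
    exact finite_transform hq hn hN ha hQ h₁ h₂ h₃ h₄ h₅ h₆ h₇)
  have hn₀ : (n : ℂ) ≠ 0 := by exact_mod_cast hn.pos.ne'
  have e₁ : ∑ k ∈ range n, (0 : ℂ) ^ (2 * k) * Q ^ (k ^ 2) /
      ∏ i ∈ range k, (Q ^ (2 * i + 2) - 1) = 1 := by
    rw [sum_eq_single_of_mem 0 (mem_range.2 hn.pos) fun k _ hk => by simp [hk]]
    simp
  have e₂ : ∑ k ∈ range (N + 1), a k * (0 : ℂ) ^ k = 1 := by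
    rw [sum_eq_single_of_mem 0 (mem_range.2 N.succ_pos) fun k _ hk => by simp [hk]]
    simp [ha₀]
  have e₃ : ∀ m : ℕ, q ^ m * (q ^ m) ^ (n - 1) = 1 := fun m => by
    rw [mul_pow_sub_one hn.pos.ne', ← pow_mul, mul_comm, pow_mul, hq.pow_eq_one, one_pow]
  have e₄ : Q * Q ^ (n - 1) = 1 := by rw [mul_pow_sub_one hn.pos.ne', hQp.pow_eq_one]
  simp only [one_mul, zero_mul, neg_zero, qPoch_base_zero, div_one, e₁, e₂, e₃, e₄, one_pow,
    mul_one, sum_const, card_range, nsmul_eq_mul, hq.qPoch_pred hn.pos, hQp.qPoch_pred hn.pos,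
    hQp.qPoch_neg_pred hn] at heq
  refine mul_left_cancel₀ (mul_ne_zero hn₀ hn₀) ?_
  linear_combination heq

end Limit

/-- μ(ζ) = φ(ζ²) at odd primitive roots of unity. -/
theorem mu_eq_phi_sq_at_primitive_root
    (n : ℕ) (hn : 0 < n) (hodd : Odd n) (ζ : ℂ) (hζ : IsPrimitiveRoot ζ n) :
    ∑ k ∈ Finset.range ((n - 1) / 2 + 1),
        (-1 : ℂ) ^ k * qPoch ζ (ζ ^ 2) k / qPoch (-ζ) ζ k =
      ∑ k ∈ Finset.range ((n - 1) / 2 + 1),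
        (-1 : ℂ) ^ k * ζ ^ (2 * k ^ 2) * qPoch (ζ ^ 2) (ζ ^ 4) k /
          qPoch (-ζ ^ 2) (ζ ^ 2) (2 * k) := by
  have ⟨N, hN⟩ := hodd
  have hζn : ζ * (ζ ^ 2) ^ N = 1 := by
    rw [← pow_mul, ← pow_succ', ← hN, hζ.pow_eq_one]
  have hQ : IsPrimitiveRoot (ζ ^ 2) n := hζ.pow_of_coprime 2 (Nat.coprime_two_left.2 hodd)
  have hQ' : IsPrimitiveRoot ((ζ ^ 2) ^ 2) n := hQ.pow_of_coprime 2 (Nat.coprime_two_left.2 hodd)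
  have hQne : ∀ {x : ℂ}, IsPrimitiveRoot x n → ∀ k < n, qPoch x x k ≠ 0 := fun hx k hk =>
    qPoch_ne_zero_of_forall fun j hj => by
      rw [← pow_succ']
      exact hx.pow_ne_one_of_pos_of_lt (by omega) (by omega)
  have hhalf : (n - 1) / 2 = N := by omega
  rw [hhalf]
  have hmain := sum_mul_qPoch_eq_sum (Q := ζ ^ 2) (N := N)
    (a := fun k => (-1) ^ k * qPoch ζ (ζ ^ 2) k / qPoch (ζ ^ 2) (ζ ^ 2) k) hζ hodd hζn
    (fun k hk => by
      have h₁ := hQne hQ (k + 1) (by omega)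
      have h₂ := hQne hQ k (by omega)
      rw [div_mul_eq_mul_div, mul_div_assoc', div_eq_div_iff h₁ h₂, qPoch_succ, qPoch_succ]
      ring)
    (by simp [qPoch_zero]) rfl
  calc _ = _ := sum_congr rfl fun k hk => by
        have hk' := mem_range.1 hk
        have h₁ := hQne hζ k (by omega)
        have h₂ := qPoch_neg_self_ne_zero hζ.pow_eq_one hodd k
        rw [← qPoch_mul_neg]
        field_simp
    _ = _ := hmain
    _ = _ := by
        have hsub : range (N + 1) ⊆ range n := range_subset_range.2 (by omega)
        rw [← sum_subset hsub fun k hk hk' => by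
          rw [qPoch_eq_zero (m := n - 1) (by rw [mul_pow_sub_one hn.ne', hQ.pow_eq_one])
            (by simp only [mem_range] at hk hk'; omega), zero_div, mul_zero]]
        refine sum_congr rfl fun k hk => ?_
        have hk' := mem_range.1 hk
        have h₁ := hQne hQ' k (by omega)
        have hprod : ∏ i ∈ range k, ((ζ ^ 2) ^ (2 * i + 2) - 1) =
            (-1) ^ k * qPoch ((ζ ^ 2) ^ 2) ((ζ ^ 2) ^ 2) k := by
          nth_rewrite 2 [← card_range k]
          rw [qPoch, ← prod_const, ← prod_mul_distrib]
          exact prod_congr rfl fun i _ => by ring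
        have hneg : ((-1 : ℂ) ^ k) * (-1) ^ k = 1 := by rw [← mul_pow]; simp
        have h₂ := qPoch_neg_self_ne_zero hQ.pow_eq_one hodd (2 * k)
        have h₃ : (-1 : ℂ) ^ k ≠ 0 := pow_ne_zero k (by norm_num)
        rw [hprod, qPoch_two_mul (ζ ^ 2) (ζ ^ 2), ← sq (ζ ^ 2), pow_mul ζ 2 (k ^ 2),
          show ζ ^ 4 = (ζ ^ 2) ^ 2 by ring, mul_div_assoc', div_mul_eq_mul_div,
          div_div, div_eq_div_iff (mul_ne_zero (mul_ne_zero h₃ h₁) h₂) h₂]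
        linear_combination (-(ζ ^ 2) ^ (k ^ 2) * qPoch (ζ ^ 2) ((ζ ^ 2) ^ 2) k *
          qPoch ((ζ ^ 2) ^ 2) ((ζ ^ 2) ^ 2) k * qPoch (-ζ ^ 2) (ζ ^ 2) (2 * k)) * hneg
end

section
/- Let n be an odd positive integer and let ζ ∈ ℂ be a primitive n-th root of unity. Then Σ_{k=0}^{(n-1)/2} ζ^{k} (ζ;ζ²)_k / (-ζ;ζ)_{2k} = Σ_{k=0}^{(n-1)/2} (-1)^k ζ^{-k²} (ζ^{-1};ζ^{-2})_k / (-ζ^{-1};ζ^{-1})_{2k}. That is, the function φ'(q) = Σ_{k≥0} q^k (q;q²)_k / (-q;q)_{2k} satisfies φ'(ζ) = φ(ζ^{-1}), where φ is Ramanujan's sixth order mock theta function. -/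
theorem qPoch_inv_sq {q : ℂ} (hq : q ≠ 0) (k : ℕ) :
    qPoch q⁻¹ (q⁻¹ ^ 2) k = (-1) ^ k * (q ^ (k ^ 2))⁻¹ * qPoch q (q ^ 2) k := by
  induction k with
  | zero => simp [qPoch]
  | succ k ih =>
    unfold qPoch at ih ⊢
    rw [Finset.prod_range_succ, Finset.prod_range_succ, ih]
    generalize ∏ j ∈ Finset.range k, (1 - q * (q ^ 2) ^ j) = P
    have h : q ^ (k ^ 2) ≠ 0 := pow_ne_zero _ hq
    have e : q ^ ((k + 1) ^ 2) = q ^ (k ^ 2) * (q * (q ^ 2) ^ k) := by ring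
    have hk : (q ^ 2) ^ k ≠ 0 := pow_ne_zero _ (pow_ne_zero _ hq)
    simp only [e, inv_pow, pow_succ (-1 : ℂ)]
    generalize (q ^ 2) ^ k = y at *
    field_simp
    ring

theorem qPoch_neg_inv {q : ℂ} (hq : q ≠ 0) (k : ℕ) :
    qPoch (-q⁻¹) q⁻¹ (2 * k) = (q ^ (2 * k ^ 2 + k))⁻¹ * qPoch (-q) q (2 * k) := by
  induction k with
  | zero => simp [qPoch]
  | succ k ih =>
    unfold qPoch at ih ⊢
    rw [show 2 * (k + 1) = 2 * k + 1 + 1 by ring]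
    simp only [Finset.prod_range_succ]
    rw [ih]
    generalize ∏ j ∈ Finset.range (2 * k), (1 - -q * q ^ j) = P
    have h : q ^ (2 * k ^ 2 + k) ≠ 0 := pow_ne_zero _ hq
    have e : q ^ (2 * (k + 1) ^ 2 + (k + 1)) =
        q ^ (2 * k ^ 2 + k) * (q ^ (2 * k) * q ^ (2 * k) * q ^ 3) := by ring
    have hk : q ^ (2 * k) ≠ 0 := pow_ne_zero _ hq
    rw [e, inv_pow, inv_pow, pow_succ q (2 * k)]
    generalize q ^ (2 * k) = y at *
    field_simp
    ring

/-- φ'(ζ) = φ(ζ⁻¹) at odd primitive roots of unity. -/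
theorem phi'_eq_phi_inv_at_primitive_root
    (n : ℕ) (hn : 0 < n) (hodd : Odd n) (ζ : ℂ) (hζ : IsPrimitiveRoot ζ n) :
    ∑ k ∈ Finset.range ((n - 1) / 2 + 1),
        ζ ^ k * qPoch ζ (ζ ^ 2) k / qPoch (-ζ) ζ (2 * k) =
      ∑ k ∈ Finset.range ((n - 1) / 2 + 1),
        (-1 : ℂ) ^ k * ζ ^ (-(k ^ 2 : ℤ)) * qPoch ζ⁻¹ (ζ⁻¹ ^ 2) k /
          qPoch (-ζ⁻¹) ζ⁻¹ (2 * k) := by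
  have h0 : ζ ≠ 0 := hζ.ne_zero hn.ne'
  refine Finset.sum_congr rfl fun k _ => ?_
  have hz : ζ ^ (-(k ^ 2 : ℤ)) = (ζ ^ (k ^ 2))⁻¹ := by
    rw [zpow_neg]
    exact_mod_cast rfl
  have hs : (-1 : ℂ) ^ k * (-1) ^ k = 1 := by rw [← mul_pow]; simp
  have e : ζ ^ (2 * k ^ 2 + k) = ζ ^ (k ^ 2) * ζ ^ (k ^ 2) * ζ ^ k := by ring
  have h : ζ ^ (k ^ 2) ≠ 0 := pow_ne_zero _ h0
  rw [qPoch_inv_sq h0, qPoch_neg_inv h0, hz, e, div_eq_mul_inv, div_eq_mul_inv, mul_inv, inv_inv]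
  generalize (qPoch (-ζ) ζ (2 * k))⁻¹ = D
  generalize qPoch ζ (ζ ^ 2) k = P
  calc ζ ^ k * P * D
      = ((-1) ^ k * (-1) ^ k) * (ζ ^ (k ^ 2) * (ζ ^ (k ^ 2))⁻¹) ^ 2 * (ζ ^ k * P * D) := by
        rw [hs, mul_inv_cancel₀ h]; ring
    _ = _ := by ring
end
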